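/- arXiv:2403.02861 — 8 statements merged into one kernel-verified Lean document; each statement's English description precedes it below -/
import Mathlib

section
/- Let n ≥ 1, let α > 0, let c ∈ ℝ^n, and let x ∈ S with x_i > 0 for all i. Define y ∈ ℝ^n by y_i = x_i e^{-α c_i} / (Σ_{j=1}^n x_j e^{-α c_j}). Then y ∈ S, y_i > 0 for all i, and y is the unique minimizer over z ∈ S of the function z ↦ ⟨c, z⟩ + (1/α) D(z, x). -/
open Finset Filter Topology

noncomputable def klS (a b : ℝ) : ℝ := if a = 0 then b else a * Real.log (a / b) - a + b

noncomputable def kl {n : ℕ} (x y : Fin n → ℝ) : ℝ := ∑ i, klS (x i) (y i)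

def probSimplex (n : ℕ) : Set (Fin n → ℝ) := {x | (∑ i, x i) = 1 ∧ ∀ i, 0 ≤ x i}

noncomputable def suppF {n : ℕ} (x : Fin n → ℝ) : Finset (Fin n) :=
  Finset.univ.filter (fun i => x i ≠ 0)

noncomputable def l0 {n : ℕ} (x : Fin n → ℝ) : ℕ := (suppF x).card

lemma klS_self {a : ℝ} (ha : 0 < a) : klS a a = 0 := by
  simp [klS, ha.ne']

lemma klS_pos {a b : ℝ} (ha : 0 ≤ a) (hb : 0 < b) (hab : a ≠ b) : 0 < klS a b := by
  rcases ha.eq_or_lt with rfl | ha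
  · simpa [klS] using hb
  · have hne : b / a ≠ 1 := fun h => hab ((div_eq_one_iff_eq ha.ne').1 h).symm
    have hlog := Real.log_lt_sub_one_of_pos (div_pos hb ha) hne
    have hmul := mul_lt_mul_of_pos_left hlog ha
    have hcancel : a * (b / a - 1) = b - a := by field_simp
    rw [klS, if_neg ha.ne', ← inv_div b a, Real.log_inv]
    linarith

lemma klS_nonneg {a b : ℝ} (ha : 0 ≤ a) (hb : 0 < b) : 0 ≤ klS a b := by
  rcases eq_or_ne a b with rfl | hab
  · exact (klS_self hb).ge
  · exact (klS_pos ha hb hab).le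

lemma kl_self {n : ℕ} {x : Fin n → ℝ} (hx : ∀ i, 0 < x i) : kl x x = 0 :=
  Finset.sum_eq_zero fun i _ => klS_self (hx i)

lemma kl_pos {n : ℕ} {x y : Fin n → ℝ} (hx : ∀ i, 0 ≤ x i) (hy : ∀ i, 0 < y i)
    (hxy : x ≠ y) : 0 < kl x y := by
  obtain ⟨i, hi⟩ := Function.ne_iff.1 hxy
  exact Finset.sum_pos' (fun j _ => klS_nonneg (hx j) (hy j))
    ⟨i, Finset.mem_univ i, klS_pos (hx i) (hy i) hi⟩

lemma klS_eq_klS_add {a b c : ℝ} (hb : 0 < b) (hc : 0 < c) :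
    klS a c = klS a b + a * Real.log (b / c) - b + c := by
  rcases eq_or_ne a 0 with rfl | ha
  · simp [klS]
  · rw [klS, klS, if_neg ha, if_neg ha, Real.log_div ha hc.ne', Real.log_div ha hb.ne',
      Real.log_div hb.ne' hc.ne']
    ring

lemma kl_eq_kl_add {n : ℕ} (z : Fin n → ℝ) {x y : Fin n → ℝ} (hx : ∀ i, 0 < x i)
    (hy : ∀ i, 0 < y i) :
    kl z x = kl z y + ∑ i, z i * Real.log (y i / x i) - ∑ i, y i + ∑ i, x i := by
  rw [kl, kl, ← Finset.sum_add_distrib, ← Finset.sum_sub_distrib, ← Finset.sum_add_distrib]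
  exact Finset.sum_congr rfl fun i _ => klS_eq_klS_add (hy i) (hx i)

/-- the Bregman (KL) proximal step over the simplex has the closed-form
multiplicative-update solution, which is positive and the unique minimizer. -/
theorem stmt_0 (n : ℕ) (hn : 1 ≤ n) (α : ℝ) (hα : 0 < α) (c x : Fin n → ℝ)
    (hx : x ∈ probSimplex n) (hxpos : ∀ i, 0 < x i)
    (y : Fin n → ℝ)
    (hy : ∀ i, y i = x i * Real.exp (-α * c i) / ∑ j, x j * Real.exp (-α * c j)) :
    y ∈ probSimplex n ∧ (∀ i, 0 < y i) ∧
      ∀ z ∈ probSimplex n, z ≠ y →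
        (∑ i, c i * y i) + (1 / α) * kl y x < (∑ i, c i * z i) + (1 / α) * kl z x := by
  have hterm : ∀ j, 0 < x j * Real.exp (-α * c j) := fun j => mul_pos (hxpos j) (Real.exp_pos _)
  have hZ : 0 < ∑ j, x j * Real.exp (-α * c j) :=
    Finset.sum_pos (fun j _ => hterm j) ⟨⟨0, hn⟩, Finset.mem_univ _⟩
  set Z := ∑ j, x j * Real.exp (-α * c j) with hZdef
  have hypos : ∀ i, 0 < y i := fun i => by
    rw [hy i]
    exact div_pos (hterm i) hZ
  have hysum : ∑ i, y i = 1 := by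
    simp only [hy]
    rw [← Finset.sum_div, ← hZdef, div_self hZ.ne']
  have hymem : y ∈ probSimplex n := ⟨hysum, fun i => (hypos i).le⟩
  have hlog : ∀ i, Real.log (y i / x i) = -α * c i - Real.log Z := fun i => by
    have hxi := (hxpos i).ne'
    have hquot : y i / x i = Real.exp (-α * c i) / Z := by
      rw [hy i]
      field_simp
    rw [hquot, Real.log_div (Real.exp_pos _).ne' hZ.ne', Real.log_exp]
  have hobj : ∀ z ∈ probSimplex n,
      (∑ i, c i * z i) + (1 / α) * kl z x = (1 / α) * kl z y - (1 / α) * Real.log Z := by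
    intro z hz
    have hlin : ∑ i, z i * Real.log (y i / x i) = -α * (∑ i, c i * z i) - Real.log Z := by
      calc ∑ i, z i * Real.log (y i / x i)
          = ∑ i, (-α * (c i * z i) - z i * Real.log Z) :=
            Finset.sum_congr rfl fun i _ => by rw [hlog i]; ring
        _ = -α * (∑ i, c i * z i) - Real.log Z := by
            rw [Finset.sum_sub_distrib, ← Finset.mul_sum, ← Finset.sum_mul, hz.1, one_mul]
    rw [kl_eq_kl_add z hxpos hypos, hlin, hysum, hx.1]
    field_simp
    ring
  refine ⟨hymem, hypos, fun z hz hzy => ?_⟩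
  rw [hobj y hymem, hobj z hz, kl_self hypos]
  have hgap := mul_pos (one_div_pos.2 hα) (kl_pos hz.2 hypos hzy)
  linarith
end

section
/- Let n ≥ 1, let α, λ > 0, let f : ℝ^n → ℝ be differentiable, and let x ∈ S with x_i > 0 for all i. Set c = ∇f(x) and define y ∈ ℝ^n by y_i = x_i e^{-α c_i} / (Σ_{j=1}^n x_j e^{-α c_j}). Let σ be a permutation of {1,...,n} with y_{σ(1)} ≥ y_{σ(2)} ≥ ... ≥ y_{σ(n)}, let d ∈ argmin_{m∈{1,...,n}} ( -(1/α) log(Σ_{i=1}^m y_{σ(i)}) + λ m ), and set I = {σ(1),...,σ(d)}. Define x⁺ ∈ ℝ^n by x⁺_i = y_i / (Σ_{j∈I} y_j) for i ∈ I and x⁺_i = 0 otherwise. Then x⁺ ∈ S and x⁺ is a global minimizer over z ∈ S of the function z ↦ f(x) + ⟨∇f(x), z - x⟩ + (1/α) D(z, x) + λ‖z‖_0. -/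
open Finset Filter Topology

theorem klS_eq (a b : ℝ) : klS a b = a * Real.log (a / b) - a + b := by
  unfold klS
  split_ifs with h <;> simp [h]

theorem sum_le_sum_filter_val_lt_of_antitone {n : ℕ} {g : Fin n → ℝ} (hg : Antitone g)
    (A : Finset (Fin n)) :
    ∑ i ∈ A, g i ≤ ∑ i ∈ Finset.univ.filter (fun i : Fin n => (i : ℕ) < A.card), g i := by
  rcases A.eq_empty_or_nonempty with rfl | hA
  · simp
  have hpos : 0 < A.card := hA.card_pos
  have hle : A.card ≤ n := by simpa using A.card_le_univ
  set B := Finset.univ.filter (fun i : Fin n => (i : ℕ) < A.card) with hB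
  have hcard : B.card = A.card := by
    rw [hB, Fin.card_filter_val_lt, min_eq_right hle]
  let k : Fin n := ⟨A.card - 1, by omega⟩
  have key : ∑ i ∈ A, (g i - g k) ≤ ∑ i ∈ B, (g i - g k) := by
    rw [← Finset.univ_inter A, ← Finset.univ_inter B, ← Finset.sum_ite_mem, ← Finset.sum_ite_mem]
    refine Finset.sum_le_sum fun i _ => ?_
    by_cases hi : (i : ℕ) < A.card
    · have : g k ≤ g i := hg (Fin.le_def.2 (by simp only [k]; omega))
      have hiB : i ∈ B := by simp [hB, hi]
      rw [if_pos hiB]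
      split_ifs <;> linarith
    · have : g i ≤ g k := hg (Fin.le_def.2 (by simp only [k]; omega))
      have hiB : i ∉ B := by simp [hB]; omega
      rw [if_neg hiB]
      split_ifs <;> linarith
  simp only [Finset.sum_sub_distrib, Finset.sum_const, hcard] at key
  linarith

/-- Gibbs' inequality for an unnormalized positive weight `y`. -/
theorem neg_log_sum_le_sum_mul_log_div {ι : Type*} {T : Finset ι} {y z : ι → ℝ}
    (hy : ∀ i ∈ T, 0 < y i) (hz : ∀ i ∈ T, 0 ≤ z i) (hz1 : ∑ i ∈ T, z i = 1) :
    -Real.log (∑ i ∈ T, y i) ≤ ∑ i ∈ T, z i * Real.log (z i / y i) := by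
  have hT : T.Nonempty := by
    rw [Finset.nonempty_iff_ne_empty]
    rintro rfl
    simp at hz1
  have hY : 0 < ∑ i ∈ T, y i := Finset.sum_pos hy hT
  set Y := ∑ i ∈ T, y i with hYdef
  have key : ∑ i ∈ T, (z i * -Real.log Y + z i - y i / Y) ≤
      ∑ i ∈ T, z i * Real.log (z i / y i) := by
    refine Finset.sum_le_sum fun i hi => ?_
    have hyi := hy i hi
    rcases (hz i hi).eq_or_lt with h | h
    · rw [← h]
      have := div_pos hyi hY
      simp only [zero_mul]
      linarith
    · have h1 := Real.one_sub_inv_le_log_of_pos (x := z i / y i * Y) (by positivity)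
      rw [Real.log_mul (by positivity) hY.ne'] at h1
      have h2 := mul_le_mul_of_nonneg_left h1 h.le
      have h3 : z i * (1 - (z i / y i * Y)⁻¹) = z i - y i / Y := by field_simp
      rw [h3] at h2
      linarith
  rw [Finset.sum_sub_distrib, Finset.sum_add_distrib, ← Finset.sum_mul, ← Finset.sum_div, hz1,
    ← hYdef, div_self hY.ne'] at key
  linarith

theorem ContinuousLinearMap.apply_eq_sum_mul_single {n : ℕ} (L : (Fin n → ℝ) →L[ℝ] ℝ)
    (v : Fin n → ℝ) : L v = ∑ i, v i * L (Pi.single i 1) := by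
  conv_lhs => rw [pi_eq_sum_univ' v]
  simp only [map_sum, map_smul, smul_eq_mul]

theorem sum_mul_add_kl_eq {n : ℕ} {α Z : ℝ} (hα : α ≠ 0) (hZ : 0 < Z) {x c y z : Fin n → ℝ}
    (hx : x ∈ probSimplex n) (hxpos : ∀ i, 0 < x i)
    (hy : ∀ i, y i = x i * Real.exp (-α * c i) / Z) (hz : z ∈ probSimplex n) :
    ∑ i, z i * c i + (1 / α) * kl z x =
      (1 / α) * (∑ i, z i * Real.log (z i / y i) - Real.log Z) := by
  have key : ∀ i, klS (z i) (x i) =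
      z i * Real.log (z i / y i) - α * (z i * c i) - z i * Real.log Z - z i + x i := by
    intro i
    rw [klS_eq, hy i]
    have hxi := hxpos i
    rcases (hz.2 i).eq_or_lt with h | h
    · simp [← h]
    · rw [Real.log_div h.ne' hxi.ne', Real.log_div h.ne' (by positivity),
        Real.log_div (by positivity) hZ.ne', Real.log_mul hxi.ne' (Real.exp_pos _).ne',
        Real.log_exp]
      ring
  simp only [kl, key, Finset.sum_add_distrib, Finset.sum_sub_distrib, ← Finset.sum_mul,
    ← Finset.mul_sum, hz.1, hx.1]
  field_simp
  ring

/-- the sort-and-remove construction yields a global minimizer of the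
$\ell_0$-regularized Bregman proximal subproblem over the simplex. -/
theorem stmt_2 (n : ℕ) (hn : 1 ≤ n) (α lam : ℝ) (hα : 0 < α) (hlam : 0 < lam)
    (f : (Fin n → ℝ) → ℝ) (hf : Differentiable ℝ f)
    (x : Fin n → ℝ) (hx : x ∈ probSimplex n) (hxpos : ∀ i, 0 < x i)
    (c : Fin n → ℝ) (hc : ∀ i, c i = fderiv ℝ f x (Pi.single i 1))
    (y : Fin n → ℝ)
    (hy : ∀ i, y i = x i * Real.exp (-α * c i) / ∑ j, x j * Real.exp (-α * c j))
    (σ : Equiv.Perm (Fin n)) (hσ : ∀ i j : Fin n, i ≤ j → y (σ j) ≤ y (σ i))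
    (d : ℕ) (hd1 : 1 ≤ d) (hdn : d ≤ n)
    (hdmin : ∀ m : ℕ, 1 ≤ m → m ≤ n →
      -(1 / α) * Real.log (∑ i ∈ Finset.univ.filter (fun i : Fin n => (i : ℕ) < d), y (σ i))
          + lam * d ≤
      -(1 / α) * Real.log (∑ i ∈ Finset.univ.filter (fun i : Fin n => (i : ℕ) < m), y (σ i))
          + lam * m)
    (I : Finset (Fin n)) (hI : I = (Finset.univ.filter (fun i : Fin n => (i : ℕ) < d)).image σ)
    (xplus : Fin n → ℝ)
    (hxplus : ∀ i, xplus i = if i ∈ I then y i / ∑ j ∈ I, y j else 0) :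
    xplus ∈ probSimplex n ∧
      ∀ z ∈ probSimplex n,
        f x + fderiv ℝ f x (xplus - x) + (1 / α) * kl xplus x + lam * (l0 xplus : ℝ) ≤
        f x + fderiv ℝ f x (z - x) + (1 / α) * kl z x + lam * (l0 z : ℝ) := by
  set Z := ∑ j, x j * Real.exp (-α * c j) with hZdef
  have hZ : 0 < Z :=
    Finset.sum_pos (fun j _ => mul_pos (hxpos j) (Real.exp_pos _)) ⟨⟨0, hn⟩, Finset.mem_univ _⟩
  have hypos : ∀ i, 0 < y i := fun i => by
    rw [hy i]
    exact div_pos (mul_pos (hxpos i) (Real.exp_pos _)) hZ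
  have hIcard : I.card = d := by
    rw [hI, Finset.card_image_of_injective _ σ.injective, Fin.card_filter_val_lt,
      min_eq_right hdn]
  have hY : 0 < ∑ j ∈ I, y j :=
    Finset.sum_pos (fun j _ => hypos j) (Finset.card_pos.1 (by omega))
  have hIsum : ∑ i ∈ Finset.univ.filter (fun i : Fin n => (i : ℕ) < d), y (σ i) =
      ∑ j ∈ I, y j := by
    rw [hI, Finset.sum_image fun a _ b _ h => σ.injective h]
  have hl0 : l0 xplus = d := by
    rw [← hIcard, l0, suppF]
    congr 1
    ext i
    rw [Finset.mem_filter, hxplus i]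
    split_ifs with h <;> simp [h, (hypos i).ne', hY.ne']
  have hmem : xplus ∈ probSimplex n := by
    refine ⟨?_, fun i => ?_⟩
    · simp only [hxplus]
      rw [Finset.sum_ite_mem, Finset.univ_inter, ← Finset.sum_div, div_self hY.ne']
    · rw [hxplus i]
      split_ifs
      · exact (div_pos (hypos i) hY).le
      · exact le_rfl
  have hval : ∀ z ∈ probSimplex n, fderiv ℝ f x (z - x) + (1 / α) * kl z x =
      (1 / α) * (∑ i, z i * Real.log (z i / y i) - Real.log Z) - fderiv ℝ f x x := by
    intro z hz
    rw [← sum_mul_add_kl_eq hα.ne' hZ hx hxpos hy hz, map_sub,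
      ContinuousLinearMap.apply_eq_sum_mul_single _ z]
    simp only [← hc]
    ring
  have hplus : ∑ i, xplus i * Real.log (xplus i / y i) = -Real.log (∑ j ∈ I, y j) := by
    have : ∀ i, xplus i * Real.log (xplus i / y i) = xplus i * -Real.log (∑ j ∈ I, y j) := by
      intro i
      rw [hxplus i]
      split_ifs
      · rw [div_div_cancel_left' (hypos i).ne', Real.log_inv]
      · simp
    simp only [this]
    rw [← Finset.sum_mul, hmem.1, one_mul]
  refine ⟨hmem, fun z hz => ?_⟩
  have hsupp : ∀ i, i ∉ suppF z → z i = 0 := fun i hi => by simpa [suppF] using hi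
  have hz1 : ∑ i ∈ suppF z, z i = 1 := by
    rw [← hz.1]
    exact Finset.sum_subset (Finset.subset_univ _) fun i _ hi => hsupp i hi
  have hne : (suppF z).Nonempty := by
    rw [Finset.nonempty_iff_ne_empty]
    intro h
    simp [h] at hz1
  have hgibbs := neg_log_sum_le_sum_mul_log_div (fun i _ => hypos i) (fun i _ => hz.2 i) hz1
  have hzsum : ∑ i ∈ suppF z, z i * Real.log (z i / y i) = ∑ i, z i * Real.log (z i / y i) :=
    Finset.sum_subset (Finset.subset_univ _) fun i _ hi => by simp [hsupp i hi]
  rw [hzsum] at hgibbs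
  have hsort := sum_le_sum_filter_val_lt_of_antitone (g := fun i => y (σ i))
    (fun i j h => hσ i j h) ((suppF z).image σ.symm)
  rw [Finset.card_image_of_injective _ σ.symm.injective,
    Finset.sum_image fun a _ b _ h => σ.symm.injective h] at hsort
  simp only [Equiv.apply_symm_apply] at hsort
  have hlog := Real.log_le_log (Finset.sum_pos (fun i _ => hypos i) hne) hsort
  have hmin := hdmin (suppF z).card hne.card_pos (by simpa using (suppF z).card_le_univ)
  rw [hIsum] at hmin
  have hxv := hval xplus hmem
  rw [hplus] at hxv
  have hscaled := mul_le_mul_of_nonneg_left (hgibbs.trans' (neg_le_neg hlog))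
    (one_div_pos.2 hα).le
  have hzv := hval z hz
  rw [hl0, l0]
  linarith
end

section
/- Let n ≥ 2, let α, λ > 0, and let y_1 ≥ y_2 ≥ ... ≥ y_n ≥ 0 with y_1 > 0. Define l(m) = -(1/α) log(Σ_{i=1}^m y_i) + λ m for m ∈ {1,...,n}. Then the sequence of first differences m ↦ l(m+1) - l(m) satisfies l(m+1) - l(m) = -(1/α) log(1 + y_{m+1} / Σ_{i=1}^m y_i) + λ and is nondecreasing in m for m = 1,...,n-1. -/
open Finset Filter Topology

/-- formula for the first differences of l and their monotonicity. -/
theorem stmt_3 (n : ℕ) (hn : 2 ≤ n) (α lam : ℝ) (hα : 0 < α) (hlam : 0 < lam)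
    (y : ℕ → ℝ) (hmono : ∀ m, 1 ≤ m → m + 1 ≤ n → y (m + 1) ≤ y m)
    (hnonneg : ∀ m, 1 ≤ m → m ≤ n → 0 ≤ y m) (hy1 : 0 < y 1)
    (l : ℕ → ℝ)
    (hl : ∀ m, l m = -(1 / α) * Real.log (∑ i ∈ Finset.Icc 1 m, y i) + lam * m) :
    (∀ m, 1 ≤ m → m + 1 ≤ n →
        l (m + 1) - l m
          = -(1 / α) * Real.log (1 + y (m + 1) / ∑ i ∈ Finset.Icc 1 m, y i) + lam) ∧
    (∀ m m', 1 ≤ m → m ≤ m' → m' + 1 ≤ n → l (m + 1) - l m ≤ l (m' + 1) - l m') := by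
  have hpos : ∀ m, 1 ≤ m → m ≤ n → 0 < ∑ i ∈ Finset.Icc 1 m, y i := fun m h1 hm =>
    Finset.sum_pos'
      (fun i hi => hnonneg i (Finset.mem_Icc.1 hi).1 ((Finset.mem_Icc.1 hi).2.trans hm))
      ⟨1, Finset.mem_Icc.2 ⟨le_rfl, h1⟩, hy1⟩
  have hdiff : ∀ m, 1 ≤ m → m + 1 ≤ n → l (m + 1) - l m
      = -(1 / α) * Real.log (1 + y (m + 1) / ∑ i ∈ Finset.Icc 1 m, y i) + lam := by
    intro m h1 hm
    have hS := hpos m h1 (by lia)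
    have hS' := hpos (m + 1) (by lia) hm
    have hsum := Finset.sum_Icc_succ_top (show 1 ≤ m + 1 by lia) y
    rw [hl, hl, one_add_div hS.ne', ← hsum, Real.log_div hS'.ne' hS.ne']
    push_cast
    ring
  refine ⟨hdiff, fun m m' h1 hmm' hm' => ?_⟩
  have hanti : y (m' + 1) ≤ y (m + 1) := by
    induction m', hmm' using Nat.le_induction with
    | base => exact le_rfl
    | succ k hk ih => exact (hmono (k + 1) (by lia) hm').trans (ih (by lia))
  have hS := hpos m h1 (by lia)
  have hy' := hnonneg (m' + 1) (by lia) hm'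
  have hsum : ∑ i ∈ Finset.Icc 1 m, y i ≤ ∑ i ∈ Finset.Icc 1 m', y i :=
    Finset.sum_le_sum_of_subset_of_nonneg (Finset.Icc_subset_Icc_right hmm') fun i hi _ =>
      hnonneg i (Finset.mem_Icc.1 hi).1 (by have := (Finset.mem_Icc.1 hi).2; lia)
  have hdiv := div_le_div₀ (hy'.trans hanti) hanti hS hsum
  have hratio := div_nonneg hy' (hS.le.trans hsum)
  rw [hdiff m h1 (by lia), hdiff m' (by lia) hm']
  have hlog := Real.log_le_log (by linarith) (add_le_add_right hdiv 1)
  have := mul_le_mul_of_nonneg_left hlog (one_div_pos.2 hα).le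
  linarith
end

section
/- Let n ≥ 2, let α, λ > 0, and let y_1 ≥ y_2 ≥ ... ≥ y_n ≥ 0 with y_1 > 0. Define l(m) = -(1/α) log(Σ_{i=1}^m y_i) + λ m for m ∈ {1,...,n}, and let d be the largest element of argmin_{m∈{1,...,n}} l(m). Then l(m+1) ≤ l(m) for every m with 1 ≤ m ≤ d-1, and l(m+1) > l(m) for every m with d ≤ m ≤ n-1. -/
open Finset Filter Topology

/-- Partial sums of a nonincreasing, nonnegative sequence are log-concave. -/
theorem log_sum_Icc_concave {y : ℕ → ℝ} {n : ℕ}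
    (hmono : ∀ m, 1 ≤ m → m + 1 ≤ n → y (m + 1) ≤ y m)
    (hnonneg : ∀ m, 1 ≤ m → m ≤ n → 0 ≤ y m) (hy1 : 0 < y 1)
    {m : ℕ} (hm : 1 ≤ m) (hmn : m + 2 ≤ n) :
    Real.log (∑ i ∈ Finset.Icc 1 m, y i) + Real.log (∑ i ∈ Finset.Icc 1 (m + 2), y i) ≤
      2 * Real.log (∑ i ∈ Finset.Icc 1 (m + 1), y i) := by
  have hS : 0 < ∑ i ∈ Finset.Icc 1 m, y i :=
    Finset.sum_pos' (fun i hi => hnonneg i (Finset.mem_Icc.1 hi).1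
      ((Finset.mem_Icc.1 hi).2.trans (by lia))) ⟨1, Finset.mem_Icc.2 ⟨le_rfl, hm⟩, hy1⟩
  rw [Finset.sum_Icc_succ_top (by lia : 1 ≤ m + 1 + 1),
    Finset.sum_Icc_succ_top (by lia : 1 ≤ m + 1)]
  set S := ∑ i ∈ Finset.Icc 1 m, y i
  have ha : 0 ≤ y (m + 1) := hnonneg _ (by lia) (by lia)
  have hb : 0 ≤ y (m + 1 + 1) := hnonneg _ (by lia) (by lia)
  have hba : y (m + 1 + 1) ≤ y (m + 1) := hmono _ (by lia) (by lia)
  rw [← Real.log_mul (by positivity) (by positivity), two_mul,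
    ← Real.log_mul (by positivity) (by positivity)]
  apply Real.log_le_log (by positivity)
  nlinarith [mul_le_mul_of_nonneg_left hba hS.le, mul_nonneg ha ha]

/-- Increments which are nondecreasing step by step are nondecreasing. -/
theorem sub_le_sub_of_discrete_convex {l : ℕ → ℝ} {n : ℕ}
    (h : ∀ m, 1 ≤ m → m + 2 ≤ n → l (m + 1) - l m ≤ l (m + 2) - l (m + 1))
    {m k : ℕ} (hm : 1 ≤ m) (hmk : m ≤ k) (hk : k + 1 ≤ n) :
    l (m + 1) - l m ≤ l (k + 1) - l k := by
  induction k, hmk using Nat.le_induction with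
  | base => exact le_rfl
  | succ k hmk ih => exact (ih (by lia)).trans (h k (by lia) hk)

/-- l decreases up to the largest argmin d and strictly increases afterwards. -/
theorem stmt_4 (n : ℕ) (hn : 2 ≤ n) (α lam : ℝ) (hα : 0 < α) (hlam : 0 < lam)
    (y : ℕ → ℝ) (hmono : ∀ m, 1 ≤ m → m + 1 ≤ n → y (m + 1) ≤ y m)
    (hnonneg : ∀ m, 1 ≤ m → m ≤ n → 0 ≤ y m) (hy1 : 0 < y 1)
    (l : ℕ → ℝ)
    (hl : ∀ m, l m = -(1 / α) * Real.log (∑ i ∈ Finset.Icc 1 m, y i) + lam * m)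
    (d : ℕ) (hd1 : 1 ≤ d) (hdn : d ≤ n)
    (hdmin : ∀ m, 1 ≤ m → m ≤ n → l d ≤ l m)
    (hdmax : ∀ m, 1 ≤ m → m ≤ n → l m = l d → m ≤ d) :
    (∀ m, 1 ≤ m → m + 1 ≤ d → l (m + 1) ≤ l m) ∧
    (∀ m, d ≤ m → m + 1 ≤ n → l m < l (m + 1)) := by
  have hconv : ∀ m, 1 ≤ m → m + 2 ≤ n → l (m + 1) - l m ≤ l (m + 2) - l (m + 1) := by
    intro m hm hmn
    have := mul_le_mul_of_nonneg_left
      (log_sum_Icc_concave hmono hnonneg hy1 hm hmn) (one_div_pos.2 hα).le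
    simp only [hl]
    push_cast
    linarith
  constructor
  · intro m hm hmd
    obtain ⟨k, rfl⟩ : ∃ k, d = k + 1 := ⟨d - 1, by lia⟩
    have h1 := sub_le_sub_of_discrete_convex hconv hm (by lia : m ≤ k) hdn
    have h2 := hdmin k (by lia) (by lia)
    linarith
  · intro m hdm hmn
    have h1 := sub_le_sub_of_discrete_convex hconv hd1 hdm hmn
    have h2 : l d < l (d + 1) := lt_of_le_of_ne (hdmin (d + 1) (by lia) (by lia)) fun h => by
      have := hdmax (d + 1) (by lia) (by lia) h.symm
      lia
    linarith
end

section
/- Let n ≥ 1, let α, λ > 0, and let y_1 ≥ y_2 ≥ ... ≥ y_n ≥ 0 with y_1 > 0. Define l(m) = -(1/α) log(Σ_{i=1}^m y_i) + λ m for m ∈ {1,...,n}, and let d be the largest element of argmin_{m∈{1,...,n}} l(m). Then y_d > 0 and, for every i with 1 ≤ i ≤ d, y_i / (Σ_{j=1}^d y_j) ≥ 1 - e^{-αλ}. -/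
open Finset Filter Topology

/-- If lengthening a sum from `S` to `T` does not increase `-(1 / α) * log · + lam * m`, then the
increment is at least `(1 - exp (-(α * lam))) * T`. -/
lemma one_sub_exp_mul_le_sub_of_penalized_log_le {α lam S T k : ℝ} (hα : 0 < α)
    (hS : 0 < S) (hT : 0 < T)
    (h : -(1 / α) * Real.log T + lam * (k + 1) ≤ -(1 / α) * Real.log S + lam * k) :
    (1 - Real.exp (-(α * lam))) * T ≤ T - S := by
  have hlog : Real.log S ≤ Real.log T + -(α * lam) := by
    have h' := mul_le_mul_of_nonneg_left h hα.le
    have hT' : α * (-(1 / α) * Real.log T + lam * (k + 1))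
        = -Real.log T + α * lam * (k + 1) := by field_simp
    have hS' : α * (-(1 / α) * Real.log S + lam * k) = -Real.log S + α * lam * k := by
      field_simp
    rw [hT', hS'] at h'
    linarith
  have hexp := Real.exp_le_exp.mpr hlog
  rw [Real.exp_add, Real.exp_log hS, Real.exp_log hT] at hexp
  linarith

/-- A sequence decreasing on `{1, ..., n}` is antitone there. -/
lemma le_of_step_le {n : ℕ} {y : ℕ → ℝ} (hmono : ∀ m, 1 ≤ m → m + 1 ≤ n → y (m + 1) ≤ y m)
    {i d : ℕ} (hi : 1 ≤ i) (hid : i ≤ d) (hdn : d ≤ n) : y d ≤ y i := by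
  induction d, hid using Nat.le_induction with
  | base => exact le_rfl
  | succ k hk ih => exact (hmono k (hi.trans hk) hdn).trans (ih (by omega))

/-- every kept element has relative weight at least 1 - e^{-αλ}. -/
theorem stmt_13 (n : ℕ) (hn : 1 ≤ n) (α lam : ℝ) (hα : 0 < α) (hlam : 0 < lam)
    (y : ℕ → ℝ) (hmono : ∀ m, 1 ≤ m → m + 1 ≤ n → y (m + 1) ≤ y m)
    (hnonneg : ∀ m, 1 ≤ m → m ≤ n → 0 ≤ y m) (hy1 : 0 < y 1)
    (l : ℕ → ℝ)
    (hl : ∀ m, l m = -(1 / α) * Real.log (∑ i ∈ Finset.Icc 1 m, y i) + lam * m)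
    (d : ℕ) (hd1 : 1 ≤ d) (hdn : d ≤ n)
    (hdmin : ∀ m, 1 ≤ m → m ≤ n → l d ≤ l m)
    (hdmax : ∀ m, 1 ≤ m → m ≤ n → l m = l d → m ≤ d) :
    0 < y d ∧ ∀ i, 1 ≤ i → i ≤ d →
      1 - Real.exp (-(α * lam)) ≤ y i / ∑ j ∈ Finset.Icc 1 d, y j := by
  have hpos : ∀ m, 1 ≤ m → m ≤ n → 0 < ∑ j ∈ Finset.Icc 1 m, y j := fun m h1 hmn =>
    hy1.trans_le (Finset.single_le_sum
      (fun j hj => hnonneg j (Finset.mem_Icc.mp hj).1 ((Finset.mem_Icc.mp hj).2.trans hmn))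
      (Finset.mem_Icc.mpr ⟨le_rfl, h1⟩))
  have hS := hpos d hd1 hdn
  have hlt : Real.exp (-(α * lam)) < 1 :=
    Real.exp_lt_one_iff.mpr (neg_neg_of_pos (mul_pos hα hlam))
  have key : (1 - Real.exp (-(α * lam))) * ∑ j ∈ Finset.Icc 1 d, y j ≤ y d := by
    obtain ⟨k, rfl⟩ : ∃ k, d = k + 1 := ⟨d - 1, by omega⟩
    rcases Nat.eq_zero_or_pos k with rfl | hk
    · have := mul_pos (Real.exp_pos (-(α * lam))) hy1
      simp only [zero_add, Finset.Icc_self, Finset.sum_singleton]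
      linarith
    · have hmin := hdmin k hk (by omega)
      rw [hl, hl] at hmin
      push_cast at hmin
      have h := one_sub_exp_mul_le_sub_of_penalized_log_le hα (hpos k hk (by omega)) hS hmin
      have hsum := Finset.sum_Icc_succ_top (Nat.le_add_left 1 k) y
      linarith
  refine ⟨(mul_pos (sub_pos.mpr hlt) hS).trans_le key, fun i hi hid => ?_⟩
  rw [le_div_iff₀ hS]
  exact key.trans (le_of_step_le hmono hi hid hdn)
end

section
/- Let n ≥ 1, let λ > 0, and let f : ℝ^n → ℝ be continuous. Let x* ∈ S with supp(x*) nonempty, suppose δ := min{x*_i : i ∈ supp(x*)} > 0, and suppose f(x*) ≤ f(x) for every x ∈ S with supp(x) ⊆ supp(x*). Then there exists ε > 0 such that for every x ∈ S with ‖x - x*‖ < ε (Euclidean norm), one has f(x) + λ‖x‖_0 ≥ f(x*) + λ‖x*‖_0; that is, x* is a local minimizer of F(x) = f(x) + λ‖x‖_0 over S. -/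
open Finset Filter Topology

/-- a support-restricted minimizer with strictly positive support entries
is a local minimizer of the $\ell_0$-regularized objective over the simplex. -/
theorem stmt_14 (n : ℕ) (hn : 1 ≤ n) (lam : ℝ) (hlam : 0 < lam)
    (f : (Fin n → ℝ) → ℝ) (hf : Continuous f)
    (xstar : Fin n → ℝ) (hxs : xstar ∈ probSimplex n) (hne : (suppF xstar).Nonempty)
    (hδ : ∀ i ∈ suppF xstar, 0 < xstar i)
    (hmin : ∀ x ∈ probSimplex n, suppF x ⊆ suppF xstar → f xstar ≤ f x) :
    ∃ ε > 0, ∀ x ∈ probSimplex n,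
      Real.sqrt (∑ i, (x i - xstar i) ^ 2) < ε →
      f xstar + lam * (l0 xstar : ℝ) ≤ f x + lam * (l0 x : ℝ) := by
  have hnear : ∀ᶠ x in 𝓝 xstar, f xstar - lam < f x ∧ ∀ i ∈ suppF xstar, 0 < x i := by
    refine (hf.continuousAt.eventually (lt_mem_nhds (by linarith))).and ?_
    rw [Filter.eventually_all_finset]
    exact fun i hi => (continuous_apply i).continuousAt.eventually (lt_mem_nhds (hδ i hi))
  obtain ⟨ε, hε, hball⟩ := Metric.eventually_nhds_iff.mp hnear
  refine ⟨ε, hε, fun x hx hdist => ?_⟩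
  have hclose : dist x xstar < ε := by
    refine (dist_pi_lt_iff hε).mpr fun i => lt_of_le_of_lt ?_ hdist
    rw [Real.dist_eq]
    exact Real.abs_le_sqrt (Finset.single_le_sum
      (f := fun j => (x j - xstar j) ^ 2) (fun j _ => sq_nonneg _) (Finset.mem_univ i))
  obtain ⟨hfx, hpos⟩ := hball hclose
  have hsub : suppF xstar ⊆ suppF x := fun i hi => by
    simpa [suppF] using (hpos i hi).ne'
  by_cases hrev : suppF x ⊆ suppF xstar
  · have hl0 : l0 x = l0 xstar := congrArg Finset.card (hrev.antisymm hsub)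
    rw [hl0]
    linarith [hmin x hx hrev]
  · have hcard : l0 xstar + 1 ≤ l0 x := Finset.card_lt_card ⟨hsub, hrev⟩
    have hcard' : (l0 xstar : ℝ) + 1 ≤ l0 x := by exact_mod_cast hcard
    nlinarith [mul_le_mul_of_nonneg_left hcard' hlam.le]
end

section
/- Let n ≥ 1, let α, λ > 0, and let f : ℝ^n → ℝ be continuous. Let I ⊆ {1,...,n} be nonempty, and let (x^k)_{k≥0} be a sequence in S such that supp(x^k) = I and x^k_i ≥ 1 - e^{-αλ} for all i ∈ I and all k. Suppose x^k → x* as k → ∞, where x* satisfies f(x*) = min{f(x) : x ∈ S, supp(x) ⊆ I}. Then supp(x*) = I, x*_i ≥ 1 - e^{-αλ} for all i ∈ I, and x* is a local minimizer of F(x) = f(x) + λ‖x‖_0 over S, i.e., there exists ε > 0 such that F(x) ≥ F(x*) for every x ∈ S with ‖x - x*‖ < ε. -/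
open Finset Filter Topology

/-- the limit of iterates with fixed support I and entries bounded below
by 1 - e^{-αλ} keeps the support I, satisfies the same lower bound, and is a local
minimizer of the $\ell_0$-regularized objective over the simplex. -/
theorem stmt_15 (n : ℕ) (hn : 1 ≤ n) (α lam : ℝ) (hα : 0 < α) (hlam : 0 < lam)
    (f : (Fin n → ℝ) → ℝ) (hf : Continuous f)
    (I : Finset (Fin n)) (hI : I.Nonempty)
    (X : ℕ → Fin n → ℝ)
    (hXmem : ∀ k, X k ∈ probSimplex n)
    (hXsupp : ∀ k, suppF (X k) = I)
    (hXlb : ∀ k, ∀ i ∈ I, 1 - Real.exp (-(α * lam)) ≤ X k i)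
    (xstar : Fin n → ℝ) (hlim : Tendsto X atTop (nhds xstar))
    (hmin : ∀ z ∈ probSimplex n, suppF z ⊆ I → f xstar ≤ f z) :
    suppF xstar = I ∧ (∀ i ∈ I, 1 - Real.exp (-(α * lam)) ≤ xstar i) ∧
      ∃ ε > 0, ∀ z ∈ probSimplex n,
        Real.sqrt (∑ i, (z i - xstar i) ^ 2) < ε →
        f xstar + lam * (l0 xstar : ℝ) ≤ f z + lam * (l0 z : ℝ) := by
  have hm : 0 < 1 - Real.exp (-(α * lam)) := by
    have : Real.exp (-(α * lam)) < 1 := Real.exp_lt_one_iff.mpr (by nlinarith [mul_pos hα hlam])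
    linarith
  have hcoord : ∀ i, Tendsto (fun k => X k i) atTop (𝓝 (xstar i)) :=
    fun i => tendsto_pi_nhds.mp hlim i
  have hlb : ∀ i ∈ I, 1 - Real.exp (-(α * lam)) ≤ xstar i := fun i hi =>
    ge_of_tendsto' (hcoord i) fun k => hXlb k i hi
  have hsupp : suppF xstar = I := by
    ext i
    simp only [suppF, Finset.mem_filter, Finset.mem_univ, true_and]
    constructor
    · intro hne
      by_contra hi
      have hzero : ∀ k, X k i = 0 := fun k => by
        by_contra h
        exact hi (hXsupp k ▸ by simpa [suppF] using h)
      have h := hcoord i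
      simp only [hzero] at h
      exact hne (tendsto_nhds_unique h tendsto_const_nhds)
    · intro hi
      exact (hm.trans_le (hlb i hi)).ne'
  refine ⟨hsupp, hlb, ?_⟩
  obtain ⟨δ, hδ, hclose⟩ := Metric.continuous_iff.mp hf xstar lam hlam
  refine ⟨min δ (1 - Real.exp (-(α * lam))), lt_min hδ hm, fun z hz hdist => ?_⟩
  have habs : ∀ i, |z i - xstar i| < min δ (1 - Real.exp (-(α * lam))) := fun i =>
    (Real.abs_le_sqrt (Finset.single_le_sum (f := fun i => (z i - xstar i) ^ 2)
      (fun j _ => sq_nonneg _) (Finset.mem_univ i))).trans_lt hdist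
  have hsub : I ⊆ suppF z := fun i hi => by
    have h := (abs_lt.mp ((habs i).trans_le (min_le_right _ _))).1
    have hpos : 0 < z i := by linarith [hlb i hi]
    simpa [suppF] using hpos.ne'
  have hl0 : l0 xstar = I.card := congrArg Finset.card hsupp
  rw [hl0]
  rcases hsub.eq_or_ssubset with heq | hss
  · have hle := hmin z hz heq.ge
    have hl0z : l0 z = I.card := congrArg Finset.card heq.symm
    rw [hl0z]
    linarith
  · have hcard : (I.card : ℝ) + 1 ≤ l0 z := by
      exact_mod_cast Nat.succ_le_of_lt (Finset.card_lt_card hss)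
    have hf_close := hclose z <| (dist_pi_lt_iff hδ).mpr fun i =>
      (habs i).trans_le (min_le_left _ _)
    rw [Real.dist_eq] at hf_close
    have h := (abs_lt.mp hf_close).1
    nlinarith [mul_le_mul_of_nonneg_left hcard hlam.le]
end

section
/- Let n ≥ 1, let α, λ > 0, let c ∈ ℝ^n, and let x ∈ S with supp(x) nonempty. Define y ∈ ℝ^n by y_i = x_i e^{-α c_i} / (Σ_{j=1}^n x_j e^{-α c_j}). Then supp(y) = supp(x). Moreover, let σ be a permutation of {1,...,n} with y_{σ(1)} ≥ ... ≥ y_{σ(n)}, let d be the largest element of argmin_{m∈{1,...,n}} ( -(1/α) log(Σ_{i=1}^m y_{σ(i)}) + λ m ), and define x⁺ by x⁺_i = y_i / (Σ_{j∈I} y_j) for i ∈ I := {σ(1),...,σ(d)} and x⁺_i = 0 otherwise. Then d ≤ ‖x‖_0 and supp(x⁺) ⊆ supp(x). -/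
open Finset Filter Topology

lemma sum_mul_pos_of_suppF_nonempty {n : ℕ} {x w : Fin n → ℝ} (hx : ∀ i, 0 ≤ x i)
    (hw : ∀ i, 0 < w i) (hne : (suppF x).Nonempty) : 0 < ∑ j, x j * w j := by
  obtain ⟨i, hi⟩ := hne
  have hxi : x i ≠ 0 := by simpa [suppF] using hi
  exact Finset.sum_pos' (fun j _ => mul_nonneg (hx j) (hw j).le)
    ⟨i, Finset.mem_univ i, mul_pos (lt_of_le_of_ne (hx i) hxi.symm) (hw i)⟩

/-- In a decreasing arrangement of a nonnegative vector, the entries from position `l0 y` on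
vanish. -/
lemma eq_zero_of_l0_le {n : ℕ} {y : Fin n → ℝ} (hy : ∀ i, 0 ≤ y i) {σ : Equiv.Perm (Fin n)}
    (hσ : ∀ i j : Fin n, i ≤ j → y (σ j) ≤ y (σ i)) {i : Fin n} (hi : l0 y ≤ i) :
    y (σ i) = 0 := by
  by_contra h
  have hpos : 0 < y (σ i) := lt_of_le_of_ne (hy _) (Ne.symm h)
  have hsub : (Finset.Iic i).image σ ⊆ suppF y := by
    intro j hj
    obtain ⟨k, hk, rfl⟩ := Finset.mem_image.1 hj
    simpa [suppF] using (hpos.trans_le (hσ k i (Finset.mem_Iic.1 hk))).ne'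
  have hcard := Finset.card_le_card hsub
  rw [Finset.card_image_of_injective _ σ.injective, Fin.card_Iic] at hcard
  unfold l0 at hi
  omega

/-- the multiplicative update preserves the support, the number d of kept
elements is at most the sparsity of x, and the support can only shrink. -/
theorem stmt_16 (n : ℕ) (hn : 1 ≤ n) (α lam : ℝ) (hα : 0 < α) (hlam : 0 < lam)
    (c x : Fin n → ℝ) (hx : x ∈ probSimplex n) (hne : (suppF x).Nonempty)
    (y : Fin n → ℝ)
    (hy : ∀ i, y i = x i * Real.exp (-α * c i) / ∑ j, x j * Real.exp (-α * c j))
    (σ : Equiv.Perm (Fin n)) (hσ : ∀ i j : Fin n, i ≤ j → y (σ j) ≤ y (σ i))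
    (l : ℕ → ℝ)
    (hl : ∀ m, l m =
      -(1 / α) * Real.log (∑ i ∈ Finset.univ.filter (fun i : Fin n => (i : ℕ) < m), y (σ i))
        + lam * m)
    (d : ℕ) (hd1 : 1 ≤ d) (hdn : d ≤ n)
    (hdmin : ∀ m, 1 ≤ m → m ≤ n → l d ≤ l m)
    (hdmax : ∀ m, 1 ≤ m → m ≤ n → l m = l d → m ≤ d)
    (I : Finset (Fin n)) (hI : I = (Finset.univ.filter (fun i : Fin n => (i : ℕ) < d)).image σ)
    (xplus : Fin n → ℝ)
    (hxplus : ∀ i, xplus i = if i ∈ I then y i / ∑ j ∈ I, y j else 0) :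
    suppF y = suppF x ∧ d ≤ l0 x ∧ suppF xplus ⊆ suppF x := by
  obtain ⟨-, hx0⟩ := hx
  have hpos : 0 < ∑ j, x j * Real.exp (-α * c j) :=
    sum_mul_pos_of_suppF_nonempty hx0 (fun j => Real.exp_pos _) hne
  have hy0 : ∀ i, 0 ≤ y i := fun i => by
    rw [hy]
    exact div_nonneg (mul_nonneg (hx0 i) (Real.exp_pos _).le) hpos.le
  have hsupp : suppF y = suppF x := by
    ext i
    simp only [suppF, Finset.mem_filter, Finset.mem_univ, true_and, hy i, ne_eq, div_eq_zero_iff,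
      mul_eq_zero, Real.exp_ne_zero, hpos.ne', or_false]
  have hl0 : l0 y = l0 x := by rw [l0, l0, hsupp]
  refine ⟨hsupp, ?_, ?_⟩
  · by_contra! hlt
    have hsum : ∑ i ∈ Finset.univ.filter (fun i : Fin n => (i : ℕ) < l0 x), y (σ i) =
        ∑ i ∈ Finset.univ.filter (fun i : Fin n => (i : ℕ) < d), y (σ i) := by
      refine Finset.sum_subset (fun i hi => ?_) (fun i _ hi => ?_)
      · simp only [Finset.mem_filter, Finset.mem_univ, true_and] at hi ⊢
        omega
      · simp only [Finset.mem_filter, Finset.mem_univ, true_and, not_lt] at hi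
        exact eq_zero_of_l0_le hy0 hσ (hl0.trans_le hi)
    have hmin := hdmin (l0 x) (Finset.card_pos.2 hne) (hlt.le.trans hdn)
    rw [hl, hl, hsum] at hmin
    have hcast : (l0 x : ℝ) < d := by exact_mod_cast hlt
    linarith [mul_lt_mul_of_pos_left hcast hlam]
  · rw [← hsupp]
    intro i hi
    simp only [suppF, Finset.mem_filter, Finset.mem_univ, true_and] at hi ⊢
    intro h
    simp [hxplus, h] at hi
end
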